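/- Let A ∈ ℂ be nonzero and define f(z) = 4/(A·e^{z} + 1) − 3 for all z ∈ ℂ with A·e^{z} + 1 ≠ 0. Then f is a nonconstant meromorphic function on ℂ with f ≢ f', f omits the values −3 and 1 (so these are partially shared with f' vacuously), f and f' share the value −1 (f(z) = −1 if and only if f'(z) = −1 at points of analyticity), and f partially shares the value 3 with f'. In particular, f partially shares the four pairwise distinct nonzero values −3, 1, −1, 3 with f' while f ≢ f'. -/

import Mathlib

open Filter Topology

/-- The function `4 / (A e^z + 1) - 3` is not analytic at the zeros of `A e^z + 1`. -/
lemma mul_exp_add_one_ne_zero_of_analyticAt {A : ℂ} (hA : A ≠ 0) {z : ℂ}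
    (h : AnalyticAt ℂ (fun z => 4 / (A * Complex.exp z + 1) - 3) z) :
    A * Complex.exp z + 1 ≠ 0 := by
  intro h0
  have hw : HasDerivAt (fun z => A * Complex.exp z + 1) (A * Complex.exp z) z :=
    ((Complex.hasDerivAt_exp z).const_mul A).add_const 1
  have hne : ∀ᶠ y in 𝓝[≠] z, A * Complex.exp y + 1 ≠ 0 :=
    hw.eventually_ne (mul_ne_zero hA (Complex.exp_ne_zero z))
  have hlim := ((h.continuousAt.add_const 3).mul hw.continuousAt).tendsto.mono_left
    (nhdsWithin_le_nhds (s := {z}ᶜ))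
  have hconst : Tendsto (fun _ : ℂ => (4 : ℂ)) (𝓝[≠] z) (𝓝 0) := by
    refine Tendsto.congr' ?_ (by simpa [h0] using hlim)
    filter_upwards [hne] with y hy
    simp only [Pi.mul_apply]
    field_simp
  exact (by norm_num : (4 : ℂ) ≠ 0) (tendsto_nhds_unique tendsto_const_nhds hconst)

lemma hasDerivAt_four_div_mul_exp_add_one_sub_three {A z : ℂ}
    (h : A * Complex.exp z + 1 ≠ 0) :
    HasDerivAt (fun z => 4 / (A * Complex.exp z + 1) - 3)
      (-(4 * (A * Complex.exp z)) / (A * Complex.exp z + 1) ^ 2) z := by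
  have hw : HasDerivAt (fun z => A * Complex.exp z + 1) (A * Complex.exp z) z :=
    ((Complex.hasDerivAt_exp z).const_mul A).add_const 1
  simpa using ((hasDerivAt_const z (4 : ℂ)).div hw h).sub_const 3

lemma analyticAt_four_div_mul_exp_add_one_sub_three {A z : ℂ}
    (h : A * Complex.exp z + 1 ≠ 0) :
    AnalyticAt ℂ (fun z => 4 / (A * Complex.exp z + 1) - 3) z := by
  fun_prop (disch := exact h)

lemma exists_mul_exp_eq {A c : ℂ} (hA : A ≠ 0) (hc : c ≠ 0) : ∃ z, A * Complex.exp z = c :=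
  ⟨Complex.log (c / A), by rw [Complex.exp_log (div_ne_zero hc hA), mul_div_cancel₀ c hA]⟩

/-- **Example.** For `A ≠ 0`, the function `f(z) = 4/(A e^z + 1) - 3` is a nonconstant
meromorphic function with `f ≢ f'` that omits the values `-3` and `1` (hence partially
shares them with `f'`), shares the value `-1` with `f'`, and partially shares the value
`3` with `f'`; so `f` partially shares the four pairwise distinct nonzero values
`-3, 1, -1, 3` with `f'` although `f ≢ f'`. -/
theorem example_four_partially_shared_values (A : ℂ) (hA : A ≠ 0) :
    let f : ℂ → ℂ := fun z => 4 / (A * Complex.exp z + 1) - 3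
    (∀ z : ℂ, MeromorphicAt f z) ∧
    (¬ ∃ c : ℂ, ∀ z : ℂ, AnalyticAt ℂ f z → f z = c) ∧
    (¬ ∀ z : ℂ, AnalyticAt ℂ f z → deriv f z = f z) ∧
    (∀ z : ℂ, AnalyticAt ℂ f z → f z ≠ -3) ∧
    (∀ z : ℂ, AnalyticAt ℂ f z → f z ≠ 1) ∧
    (∀ z : ℂ, AnalyticAt ℂ f z → (f z = -1 ↔ deriv f z = -1)) ∧
    (∀ z : ℂ, AnalyticAt ℂ f z → f z = 3 → deriv f z = 3) := by
  intro f
  have hne {z : ℂ} (h : AnalyticAt ℂ f z) : A * Complex.exp z + 1 ≠ 0 :=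
    mul_exp_add_one_ne_zero_of_analyticAt hA h
  have hderiv {z : ℂ} (h : A * Complex.exp z + 1 ≠ 0) :
      deriv f z = -(4 * (A * Complex.exp z)) / (A * Complex.exp z + 1) ^ 2 :=
    (hasDerivAt_four_div_mul_exp_add_one_sub_three h).deriv
  have han {z : ℂ} (h : A * Complex.exp z + 1 ≠ 0) : AnalyticAt ℂ f z :=
    analyticAt_four_div_mul_exp_add_one_sub_three h
  have hf (z : ℂ) : f z = 4 / (A * Complex.exp z + 1) - 3 := rfl
  obtain ⟨z₁, h₁⟩ := exists_mul_exp_eq hA (one_ne_zero (α := ℂ))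
  obtain ⟨z₂, h₂⟩ := exists_mul_exp_eq hA (two_ne_zero (α := ℂ))
  have hz₁ : A * Complex.exp z₁ + 1 ≠ 0 := by rw [h₁]; norm_num
  have hz₂ : A * Complex.exp z₂ + 1 ≠ 0 := by rw [h₂]; norm_num
  refine ⟨fun z => ?_, ?_, fun h => ?_, fun z h e => ?_, fun z h e => ?_, fun z h => ?_,
    fun z h e => ?_⟩
  · have : AnalyticAt ℂ (fun z => A * Complex.exp z + 1) z := by fun_prop
    exact ((MeromorphicAt.const 4 z).div this.meromorphicAt).sub (MeromorphicAt.const 3 z)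
  · rintro ⟨c, hc⟩
    have := (hc z₁ (han hz₁)).trans (hc z₂ (han hz₂)).symm
    rw [hf, hf, h₁, h₂] at this
    norm_num at this
  · have := h z₂ (han hz₂)
    rw [hderiv hz₂, hf, h₂] at this
    norm_num at this
  · have := hne h
    rw [hf] at e
    field_simp at e
    exact (by norm_num : (4 : ℂ) ≠ 0) (by linear_combination e)
  · have := hne h
    rw [hf] at e
    field_simp at e
    exact mul_ne_zero hA (Complex.exp_ne_zero z) (by linear_combination (-1 / 4 : ℂ) * e)
  · have hw := hne h
    rw [hderiv hw, hf]
    generalize A * Complex.exp z = u at hw ⊢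
    constructor
    · intro e
      field_simp at e
      obtain rfl : u = 1 := by linear_combination (-1 / 2 : ℂ) * e
      norm_num
    · intro e
      field_simp at e
      have hu : (u - 1) ^ 2 = 0 := by linear_combination e
      obtain rfl : u = 1 := sub_eq_zero.mp (pow_eq_zero_iff two_ne_zero |>.mp hu)
      norm_num
  · have hw := hne h
    rw [hderiv hw]
    rw [hf] at e
    generalize A * Complex.exp z = u at hw e ⊢
    field_simp at e
    obtain rfl : u = -1 / 3 := by linear_combination (-1 / 6 : ℂ) * e
    norm_num
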